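/- For every f in the Dirichlet space 𝒟, there exist h, k ∈ ℳ(𝒟) with k(z) ≠ 0 for all z ∈ 𝔻 such that f = h/k on 𝔻. -/

import Mathlib

open Complex MeasureTheory Metric Set

/-- Membership in the Dirichlet space `𝒟`: `f` is holomorphic on the open unit
disk and its Dirichlet integral `(1/π)∫_𝔻 |f′|² dA` is finite (equivalently,
`|f′|²` is integrable on the disk). -/
def MemDirichlet (f : ℂ → ℂ) : Prop :=
  DifferentiableOn ℂ f (Metric.ball 0 1) ∧
    MeasureTheory.IntegrableOn (fun z => ‖deriv f z‖ ^ 2) (Metric.ball 0 1)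

/-- Membership in the multiplier algebra `ℳ(𝒟)` of the Dirichlet space:
`h` is holomorphic on `𝔻` and `h·f ∈ 𝒟` for every `f ∈ 𝒟`. -/
def MemMultiplierD (h : ℂ → ℂ) : Prop :=
  DifferentiableOn ℂ h (Metric.ball 0 1) ∧
    ∀ f : ℂ → ℂ, MemDirichlet f → MemDirichlet (h * f)

/-- Integration over a disk in polar coordinates, for functions continuous up to the boundary. -/
theorem setIntegral_ball_eq_polar {E : Type*} [NormedAddCommGroup E] [NormedSpace ℝ E]
    {F : ℂ → E} {R : ℝ} (hR : 0 ≤ R) (hF : ContinuousOn F (closedBall 0 R)) :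
    ∫ z in ball (0 : ℂ) R, F z =
      ∫ r in (0 : ℝ)..R, ∫ θ in (-Real.pi)..Real.pi, r • F (r * exp (θ * I)) := by
  have hpi : -Real.pi ≤ Real.pi := by linarith [Real.pi_pos]
  rw [← integral_indicator measurableSet_ball, ← Complex.integral_comp_polarCoord_symm]
  have hcont : ContinuousOn (fun p : ℝ × ℝ => p.1 • F (p.1 * exp (p.2 * I)))
      (Icc 0 R ×ˢ Icc (-Real.pi) Real.pi) := by
    refine continuousOn_fst.smul (hF.comp (by fun_prop) ?_)
    rintro ⟨r, θ⟩ ⟨hr, -⟩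
    simpa [Complex.norm_exp_ofReal_mul_I, abs_of_nonneg hr.1] using hr.2
  have hint : IntegrableOn (fun p : ℝ × ℝ => p.1 • F (p.1 * exp (p.2 * I)))
      (Ioo 0 R ×ˢ Ioo (-Real.pi) Real.pi) (volume.prod volume) :=
    (hcont.integrableOn_compact (isCompact_Icc.prod isCompact_Icc)).mono_set
      (prod_mono Ioo_subset_Icc_self Ioo_subset_Icc_self)
  have key : ∀ p ∈ polarCoord.target,
      p.1 • (ball (0 : ℂ) R).indicator F (Complex.polarCoord.symm p) =
        (Ioo 0 R ×ˢ Ioo (-Real.pi) Real.pi).indicator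
          (fun p : ℝ × ℝ => p.1 • F (p.1 * exp (p.2 * I))) p := by
    rintro ⟨r, θ⟩ ⟨hr, hθ⟩
    have hr' : 0 < r := hr
    have he : (Complex.polarCoord.symm (r, θ) : ℂ) = r * exp (θ * I) := by
      rw [Complex.polarCoord_symm_apply, Complex.exp_mul_I]
      simp
    have hn : ‖(r : ℂ) * exp (θ * I)‖ = r := by
      simp [Complex.norm_exp_ofReal_mul_I, abs_of_pos hr']
    rw [he]
    by_cases h : r < R
    · rw [indicator_of_mem (by simpa only [mem_ball_zero_iff, hn] using h),
        indicator_of_mem (by exact ⟨⟨hr', h⟩, hθ⟩)]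
    · rw [indicator_of_notMem (by simpa only [mem_ball_zero_iff, hn] using h),
        indicator_of_notMem (fun hh => h hh.1.2), smul_zero]
  have hm : MeasurableSet polarCoord.target := polarCoord.open_target.measurableSet
  rw [setIntegral_congr_fun hm key, setIntegral_indicator (measurableSet_Ioo.prod measurableSet_Ioo),
    inter_eq_right.2 (by
      rw [polarCoord_target]
      exact prod_mono (fun x hx => hx.1) subset_rfl),
    Measure.volume_eq_prod, setIntegral_prod _ hint, intervalIntegral.integral_of_le hR,
    integral_Ioc_eq_integral_Ioo]
  refine setIntegral_congr_fun measurableSet_Ioo fun r _ => ?_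
  simp only
  rw [intervalIntegral.integral_of_le hpi, integral_Ioc_eq_integral_Ioo]

/-- Twice the Wirtinger derivative with respect to `conj z`. -/
noncomputable def dbarTwo (X : ℂ → ℂ) (z : ℂ) : ℂ := fderiv ℝ X z 1 + I * fderiv ℝ X z I

theorem ContDiffAt.continuousAt_dbarTwo {X : ℂ → ℂ} {z : ℂ} (h : ContDiffAt ℝ 1 X z) :
    ContinuousAt (dbarTwo X) z := by
  have := h.continuousAt_fderiv one_ne_zero
  unfold dbarTwo
  fun_prop

/-- Green's formula on the unit disk in complex form. -/
theorem setIntegral_dbarTwo {X : ℂ → ℂ} (hX : ∀ z ∈ closedBall (0 : ℂ) 1, ContDiffAt ℝ 1 X z) :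
    ∫ z in ball (0 : ℂ) 1, dbarTwo X z =
      ∫ θ in (-Real.pi)..Real.pi, exp (θ * I) * X (exp (θ * I)) := by
  have hmem : ∀ {r : ℝ}, r ∈ Icc (0 : ℝ) 1 → ∀ θ : ℝ,
      (r : ℂ) * exp (θ * I) ∈ closedBall (0 : ℂ) 1 := fun {r} hr θ => by
    simpa [Complex.norm_exp_ofReal_mul_I, abs_of_nonneg hr.1] using hr.2
  rw [setIntegral_ball_eq_polar zero_le_one
    (fun z hz => (hX z hz).continuousAt_dbarTwo.continuousWithinAt)]
  set P : ℝ → ℝ → ℂ := fun r θ => exp (θ * I) * X (r * exp (θ * I)) +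
    r * exp (θ * I) * fderiv ℝ X (r * exp (θ * I)) (exp (θ * I)) with hP
  set Q : ℝ → ℝ → ℂ := fun r θ => - exp (θ * I) * X (r * exp (θ * I)) +
    I * exp (θ * I) * fderiv ℝ X (r * exp (θ * I)) (r * (exp (θ * I) * I)) with hQ
  have hPQ : ∀ r θ : ℝ, r • dbarTwo X (r * exp (θ * I)) = P r θ + Q r θ := fun r θ => by
    set L := fderiv ℝ X (r * exp (θ * I)) with hL
    have h1 : L (exp (θ * I)) = Real.cos θ * L 1 + Real.sin θ * L I := by
      have : exp (θ * I) = Real.cos θ • (1 : ℂ) + Real.sin θ • I := by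
        rw [Complex.exp_mul_I]; simp
      rw [this, map_add, map_smul, map_smul]; simp
    have h2 : L (r * (exp (θ * I) * I)) =
        r * (- Real.sin θ * L 1 + Real.cos θ * L I) := by
      have : r * (exp (θ * I) * I) = r • ((-Real.sin θ) • (1 : ℂ) + Real.cos θ • I) := by
        rw [Complex.exp_mul_I]
        simp only [real_smul, ofReal_neg, ofReal_cos, ofReal_sin]
        linear_combination r * Complex.sin θ * I_sq
      rw [this, map_smul, map_add, map_smul, map_smul]; simp; ring
    simp only [hP, hQ, ← hL, dbarTwo, h1, h2, real_smul]
    rw [Complex.exp_mul_I]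
    push_cast
    have h3 := Complex.sin_sq_add_cos_sq (θ : ℂ)
    linear_combination (-r * (L 1 + I * L I)) * h3
      + r * (Complex.sin θ * Complex.sin θ * L 1 - Complex.cos θ * Complex.sin θ * L I) * I_sq
  have hmaps : MapsTo (fun p : ℝ × ℝ => (p.1 : ℂ) * exp (p.2 * I)) (Icc 0 1 ×ˢ univ)
      (closedBall 0 1) := fun p hp => hmem hp.1 p.2
  have hXc : ContinuousOn (fun p : ℝ × ℝ => X (p.1 * exp (p.2 * I))) (Icc 0 1 ×ˢ univ) :=
    ContinuousOn.comp (fun z hz => (hX z hz).continuousAt.continuousWithinAt)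
      (by fun_prop) hmaps
  have hLc : ContinuousOn (fun p : ℝ × ℝ => fderiv ℝ X (p.1 * exp (p.2 * I))) (Icc 0 1 ×ˢ univ) :=
    ContinuousOn.comp (g := fderiv ℝ X)
      (fun z hz => ((hX z hz).continuousAt_fderiv one_ne_zero).continuousWithinAt)
      (by fun_prop) hmaps
  have hEc : ContinuousOn (fun p : ℝ × ℝ => exp (p.2 * I)) (Icc (0 : ℝ) 1 ×ˢ univ) :=
    Continuous.continuousOn (by fun_prop)
  have h1c : ContinuousOn (fun p : ℝ × ℝ => (p.1 : ℂ)) (Icc (0 : ℝ) 1 ×ˢ univ) :=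
    Continuous.continuousOn (by fun_prop)
  have hPc : ContinuousOn (fun p : ℝ × ℝ => P p.1 p.2) (Icc 0 1 ×ˢ univ) := by
    exact (hEc.mul hXc).add ((h1c.mul hEc).mul (hLc.clm_apply hEc))
  have hQc : ContinuousOn (fun p : ℝ × ℝ => Q p.1 p.2) (Icc 0 1 ×ˢ univ) := by
    exact (hEc.neg.mul hXc).add ((continuousOn_const.mul hEc).mul
      (hLc.clm_apply (h1c.mul (hEc.mul continuousOn_const))))
  have hur : ∀ {F : ℝ → ℝ → ℂ}, ContinuousOn (fun p : ℝ × ℝ => F p.1 p.2) (Icc 0 1 ×ˢ univ) →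
      ∀ r ∈ Icc (0 : ℝ) 1, Continuous (F r) := fun hF r hr =>
    continuousOn_univ.1 (hF.comp (f := fun θ : ℝ => (r, θ)) (by fun_prop) fun θ _ => ⟨hr, trivial⟩)
  have huθ : ∀ {F : ℝ → ℝ → ℂ}, ContinuousOn (fun p : ℝ × ℝ => F p.1 p.2) (Icc 0 1 ×ˢ univ) →
      ∀ θ : ℝ, ContinuousOn (fun r => F r θ) (uIcc 0 1) := fun hF θ => by
    rw [uIcc_of_le zero_le_one]
    exact hF.comp (f := fun r : ℝ => (r, θ)) (by fun_prop) fun r hr => ⟨hr, trivial⟩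
  have hQ0 : ∀ r ∈ Icc (0 : ℝ) 1, ∫ θ in (-Real.pi)..Real.pi, Q r θ = 0 := fun r hr => by
    rw [intervalIntegral.integral_eq_sub_of_hasDerivAt
      (f := fun θ : ℝ => I * exp (θ * I) * X (r * exp (θ * I)))
      _ ((hur hQc r hr).intervalIntegrable _ _)]
    · simp [Complex.exp_mul_I]
    · intro θ _
      have hE : HasDerivAt (fun θ : ℝ => exp (θ * I)) (exp (θ * I) * I) θ := by
        simpa using ((hasDerivAt_id (θ : ℂ)).mul_const I).cexp.comp_ofReal
      have hZ : HasDerivAt (fun θ : ℝ => (r : ℂ) * exp (θ * I)) (r * (exp (θ * I) * I)) θ :=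
        hE.const_mul _
      have hXd := ((hX _ (hmem hr θ)).differentiableAt one_ne_zero).hasFDerivAt.comp_hasDerivAt θ hZ
      refine ((hE.const_mul I).mul hXd).congr_deriv ?_
      simp only [hQ, Function.comp]
      linear_combination exp (θ * I) * X (r * exp (θ * I)) * I_sq
  have hP1 : ∀ θ : ℝ, ∫ r in (0 : ℝ)..1, P r θ = exp (θ * I) * X (exp (θ * I)) := fun θ => by
    rw [intervalIntegral.integral_eq_sub_of_hasDerivAt
      (f := fun r : ℝ => r * exp (θ * I) * X (r * exp (θ * I)))
      _ ((huθ hPc θ).intervalIntegrable)]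
    · simp
    · intro r hr
      rw [uIcc_of_le zero_le_one] at hr
      have hZ : HasDerivAt (fun r : ℝ => (r : ℂ) * exp (θ * I)) (exp (θ * I)) r := by
        simpa using ((hasDerivAt_id (r : ℂ)).mul_const (exp (θ * I))).comp_ofReal
      have hXd := ((hX _ (hmem hr θ)).differentiableAt one_ne_zero).hasFDerivAt.comp_hasDerivAt r hZ
      exact hZ.mul hXd
  have hPint : IntegrableOn (Function.uncurry P) (uIcc 0 1 ×ˢ uIcc (-Real.pi) Real.pi)
      (volume.prod volume) := by
    rw [uIcc_of_le zero_le_one]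
    exact (hPc.mono (prod_mono subset_rfl (subset_univ _))).integrableOn_compact
      (isCompact_Icc.prod isCompact_uIcc)
  have hstep : ∫ r in (0 : ℝ)..1, ∫ θ in (-Real.pi)..Real.pi, r • dbarTwo X (r * exp (θ * I)) =
      ∫ r in (0 : ℝ)..1, ∫ θ in (-Real.pi)..Real.pi, P r θ := by
    refine intervalIntegral.integral_congr fun r hr => ?_
    rw [uIcc_of_le zero_le_one] at hr
    simp only [hPQ]
    rw [intervalIntegral.integral_add ((hur hPc r hr).intervalIntegrable _ _)
      ((hur hQc r hr).intervalIntegrable _ _), hQ0 r hr, add_zero]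
  rw [hstep, intervalIntegral_intervalIntegral_swap]
  · simp only [hP1]
  · exact hPint.mono_set (prod_mono uIoc_subset_uIcc uIoc_subset_uIcc)

open scoped ComplexConjugate

/-- `X` is real continuously differentiable at `z` with `dbarTwo X z = a`. -/
def HasDbarTwoAt (X : ℂ → ℂ) (a z : ℂ) : Prop := ContDiffAt ℝ 1 X z ∧ dbarTwo X z = a

namespace HasDbarTwoAt

variable {X Y : ℂ → ℂ} {a b z : ℂ}

theorem of_differentiable (h : Differentiable ℂ X) (z : ℂ) : HasDbarTwoAt X 0 z := by
  refine ⟨(h.contDiff (n := 1)).contDiffAt.restrict_scalars ℝ, ?_⟩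
  rw [dbarTwo, ((h z).hasDerivAt.hasFDerivAt.restrictScalars ℝ).fderiv]
  simp
  linear_combination deriv X z * I_sq

theorem conj_of_differentiable (h : Differentiable ℂ X) (z : ℂ) :
    HasDbarTwoAt (fun w => conj (X w)) (2 * conj (deriv X z)) z := by
  have hc : ContDiff ℝ 1 (fun w : ℂ => conj w) := Complex.conjCLE.contDiff
  refine ⟨hc.contDiffAt.comp z ((h.contDiff (n := 1)).contDiffAt.restrict_scalars ℝ), ?_⟩
  have h1 := (h z).hasDerivAt.hasFDerivAt.restrictScalars ℝ
  have h2 : HasFDerivAt (fun w => conj (X w)) _ z := Complex.conjCLE.hasFDerivAt.comp z h1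
  rw [dbarTwo, h2.fderiv]
  simp
  linear_combination -conj (deriv X z) * I_sq

theorem add (hX : HasDbarTwoAt X a z) (hY : HasDbarTwoAt Y b z) :
    HasDbarTwoAt (fun w => X w + Y w) (a + b) z := by
  refine ⟨hX.1.add hY.1, ?_⟩
  rw [dbarTwo, ← hX.2, ← hY.2, fderiv_fun_add (hX.1.differentiableAt one_ne_zero)
    (hY.1.differentiableAt one_ne_zero)]
  simp [dbarTwo]; ring

theorem mul (hX : HasDbarTwoAt X a z) (hY : HasDbarTwoAt Y b z) :
    HasDbarTwoAt (fun w => X w * Y w) (a * Y z + X z * b) z := by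
  refine ⟨hX.1.mul hY.1, ?_⟩
  rw [dbarTwo, ← hX.2, ← hY.2, fderiv_fun_mul (hX.1.differentiableAt one_ne_zero)
    (hY.1.differentiableAt one_ne_zero)]
  simp [dbarTwo]; ring

theorem inv (hX : HasDbarTwoAt X a z) (h0 : X z ≠ 0) :
    HasDbarTwoAt (fun w => (X w)⁻¹) (-a / X z ^ 2) z := by
  refine ⟨hX.1.inv h0, ?_⟩
  have h1 := (hX.1.differentiableAt one_ne_zero).hasFDerivAt
  have h2 : HasFDerivAt (fun w => (X w)⁻¹) _ z :=
    ((hasDerivAt_inv h0).hasFDerivAt.restrictScalars ℝ).comp z h1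
  rw [dbarTwo, ← hX.2, h2.fderiv]
  simp [dbarTwo]; ring

end HasDbarTwoAt

theorem integrableOn_ball_of_continuousOn {E : Type*} [NormedAddCommGroup E] {F : ℂ → E} {R : ℝ}
    (hF : ContinuousOn F (closedBall 0 R)) : IntegrableOn F (ball 0 R) :=
  (hF.integrableOn_compact (isCompact_closedBall 0 R)).mono_set ball_subset_closedBall

/-- A weighted Hardy inequality: if `W = Re V - |p|²` satisfies `W ≥ 1` on the closed disk and
`∂W/∂n ≥ -W` on the unit circle, then `|p'|² / W` and `|∇W|² / W²` are Carleson densities for the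
Dirichlet space, with absolute constants. -/
theorem hardy_inequality {p V φ : ℂ → ℂ} (hp : Differentiable ℂ p) (hV : Differentiable ℂ V)
    (hφ : Differentiable ℂ φ) {W : ℂ → ℝ} {G : ℂ → ℂ} (hW : ∀ z, W z = (V z).re - ‖p z‖ ^ 2)
    (hG : ∀ z, G z = deriv V z - 2 * (deriv p z * conj (p z)))
    (hW1 : ∀ z ∈ closedBall (0 : ℂ) 1, 1 ≤ W z)
    (hbd : ∀ z : ℂ, ‖z‖ = 1 → - W z ≤ (z * G z).re) :
    ∫ z in ball (0 : ℂ) 1, ‖φ z‖ ^ 2 * (‖deriv p z‖ ^ 2 / W z + ‖G z‖ ^ 2 / W z ^ 2) ≤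
      4 * (∫ z in ball (0 : ℂ) 1, ‖deriv φ z‖ ^ 2) +
        2 * ∫ θ in (-Real.pi)..Real.pi, ‖φ (exp (θ * I))‖ ^ 2 := by
  have hp' : Differentiable ℂ (deriv p) := hp.deriv
  have hV' : Differentiable ℂ (deriv V) := hV.deriv
  have hφ' : Differentiable ℂ (deriv φ) := hφ.deriv
  have hWc : ∀ z, ((W z : ℝ) : ℂ) = V z * (1 / 2) + conj (V z) * (1 / 2) + -p z * conj (p z) := by
    intro z
    rw [hW, ofReal_sub, ofReal_pow, ← mul_conj', Complex.re_eq_add_conj]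
    ring
  have hWd : ∀ z, HasDbarTwoAt (fun w => (W w : ℂ)) (conj (G z)) z := fun z => by
    have h1 := (((HasDbarTwoAt.of_differentiable hV z).mul
      (HasDbarTwoAt.of_differentiable (differentiable_const (1 / 2 : ℂ)) z)).add
      ((HasDbarTwoAt.conj_of_differentiable hV z).mul
      (HasDbarTwoAt.of_differentiable (differentiable_const (1 / 2 : ℂ)) z))).add
      ((HasDbarTwoAt.of_differentiable hp.fun_neg z).mul
      (HasDbarTwoAt.conj_of_differentiable hp z))
    have h2 : (fun w => (W w : ℂ)) =
      fun w => V w * (1 / 2) + conj (V w) * (1 / 2) + -p w * conj (p w) := funext hWc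
    rw [h2]
    convert h1 using 1
    simp only [hG, map_sub, map_mul, conj_conj, map_ofNat]
    ring
  have hGd : ∀ z, HasDbarTwoAt G (-4 * ‖deriv p z‖ ^ 2) z := fun z => by
    have h1 := (HasDbarTwoAt.of_differentiable hV' z).add
      ((HasDbarTwoAt.of_differentiable (hp'.const_mul (-2)) z).mul
      (HasDbarTwoAt.conj_of_differentiable hp z))
    have h2 : G = fun w => deriv V w + (-2 * deriv p w) * conj (p w) := by
      funext w; rw [hG]; ring
    rw [h2]
    convert h1 using 1
    rw [← mul_conj']; ring
  set X : ℂ → ℂ := fun z => φ z * conj (φ z) * (G z * (W z : ℂ)⁻¹) with hX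
  have hXd : ∀ z ∈ closedBall (0 : ℂ) 1, HasDbarTwoAt X
      (2 * (φ z * conj (deriv φ z) * G z / W z) - 4 * (‖φ z‖ ^ 2 * ‖deriv p z‖ ^ 2 / W z)
        - ‖φ z‖ ^ 2 * ‖G z‖ ^ 2 / W z ^ 2) z := fun z hz => by
    have h0 : (W z : ℂ) ≠ 0 := ofReal_ne_zero.2 (by linarith [hW1 z hz])
    have h1 := ((HasDbarTwoAt.of_differentiable hφ z).mul
      (HasDbarTwoAt.conj_of_differentiable hφ z)).mul ((hGd z).mul ((hWd z).inv h0))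
    convert h1 using 1
    rw [← mul_conj' (φ z), ← mul_conj' (G z)]
    field_simp
    ring
  have hXs := fun z hz => (hXd z hz).1
  have hcW : ContinuousOn W (closedBall 0 1) := by
    have : W = fun z => (V z).re - ‖p z‖ ^ 2 := funext hW
    have h1 := hV.continuous
    have h2 := hp.continuous
    rw [this]; exact Continuous.continuousOn (by fun_prop)
  have hcG : ContinuousOn G (closedBall 0 1) :=
    fun z _ => (hGd z).1.continuousAt.continuousWithinAt
  have hcφ : ContinuousOn φ (closedBall 0 1) := hφ.continuous.continuousOn
  have hcφ' : ContinuousOn (deriv φ) (closedBall 0 1) := hφ'.continuous.continuousOn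
  have hcp' : ContinuousOn (deriv p) (closedBall 0 1) := hp'.continuous.continuousOn
  have hW0 : ∀ z ∈ closedBall (0 : ℂ) 1, W z ≠ 0 := fun z hz => by linarith [hW1 z hz]
  have hgreen := setIntegral_dbarTwo hXs
  have hcont : ContinuousOn (dbarTwo X) (closedBall 0 1) :=
    fun z hz => (hXs z hz).continuousAt_dbarTwo.continuousWithinAt
  have hbound : ∀ z ∈ closedBall (0 : ℂ) 1,
      ‖φ z‖ ^ 2 * (‖deriv p z‖ ^ 2 / W z + ‖G z‖ ^ 2 / W z ^ 2) ≤
        4 * ‖deriv φ z‖ ^ 2 - 2 * (dbarTwo X z).re := fun z hz => by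
    have hWp : 0 < W z := by linarith [hW1 z hz]
    have e1 : (dbarTwo X z).re = 2 * (φ z * conj (deriv φ z) * G z / W z).re -
        4 * (‖φ z‖ ^ 2 * ‖deriv p z‖ ^ 2 / W z) - ‖φ z‖ ^ 2 * ‖G z‖ ^ 2 / W z ^ 2 := by
      rw [(hXd z hz).2]
      have : (2 * (φ z * conj (deriv φ z) * G z / W z) - 4 * (‖φ z‖ ^ 2 * ‖deriv p z‖ ^ 2 / W z)
        - ‖φ z‖ ^ 2 * ‖G z‖ ^ 2 / W z ^ 2 : ℂ) =
        (2 : ℝ) * (φ z * conj (deriv φ z) * G z / W z) -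
        ((4 * (‖φ z‖ ^ 2 * ‖deriv p z‖ ^ 2 / W z) + ‖φ z‖ ^ 2 * ‖G z‖ ^ 2 / W z ^ 2 : ℝ) : ℂ) := by
        push_cast; ring
      rw [this, sub_re, re_ofReal_mul, ofReal_re]; ring
    have e3 : 0 ≤ ‖φ z‖ ^ 2 * ‖deriv p z‖ ^ 2 / W z := by positivity
    have e4 : ‖φ z‖ ^ 2 * ‖G z‖ ^ 2 / W z ^ 2 = (‖φ z‖ * ‖G z‖ / W z) ^ 2 := by ring
    have e5 : ‖φ z‖ ^ 2 * (‖deriv p z‖ ^ 2 / W z + ‖G z‖ ^ 2 / W z ^ 2) =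
      ‖φ z‖ ^ 2 * ‖deriv p z‖ ^ 2 / W z + (‖φ z‖ * ‖G z‖ / W z) ^ 2 := by ring
    have e6 : (φ z * conj (deriv φ z) * G z / W z).re ≤ ‖deriv φ z‖ * (‖φ z‖ * ‖G z‖ / W z) := by
      refine (re_le_norm _).trans (le_of_eq ?_)
      rw [norm_div, norm_mul, norm_mul, norm_conj, norm_real, Real.norm_of_nonneg hWp.le]
      ring
    rw [e1, e5, e4]
    nlinarith [sq_nonneg (2 * ‖deriv φ z‖ - ‖φ z‖ * ‖G z‖ / W z)]
  have hcirc : - (∫ θ in (-Real.pi)..Real.pi, ‖φ (exp (θ * I))‖ ^ 2) ≤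
      (∫ θ in (-Real.pi)..Real.pi, exp (θ * I) * X (exp (θ * I))).re := by
    have hn : ∀ θ : ℝ, exp (θ * I) ∈ closedBall (0 : ℂ) 1 := fun θ => by
      simp [Complex.norm_exp_ofReal_mul_I]
    have hc1 : Continuous fun θ : ℝ => exp (θ * I) * X (exp (θ * I)) := by
      have h1 : Continuous fun θ : ℝ => exp (θ * I) := by fun_prop
      refine h1.mul ?_
      exact continuous_iff_continuousAt.2 fun θ =>
        ContinuousAt.comp (g := X) (hXs _ (hn θ)).continuousAt h1.continuousAt
    have hc2 : Continuous fun θ : ℝ => ‖φ (exp (θ * I))‖ ^ 2 := by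
      have := hφ.continuous
      fun_prop
    have hcomm := Complex.reCLM.intervalIntegral_comp_comm
      (hc1.intervalIntegrable (μ := volume) (-Real.pi) Real.pi)
    simp only [reCLM_apply] at hcomm
    rw [← hcomm, ← intervalIntegral.integral_neg]
    refine intervalIntegral.integral_mono_on (by linarith [Real.pi_pos])
      (hc2.neg.intervalIntegrable _ _) ((continuous_re.comp hc1).intervalIntegrable _ _) ?_
    intro θ _
    set E := exp (θ * I)
    have hWp : 0 < W E := by linarith [hW1 E (hn θ)]
    have h1 : E * X E = ((‖φ E‖ ^ 2 / W E : ℝ) : ℂ) * (E * G E) := by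
      simp only [hX, mul_conj']; push_cast; ring
    rw [h1, re_ofReal_mul]
    have h2 := hbd E (by simp [E, Complex.norm_exp_ofReal_mul_I])
    have h3 : -‖φ E‖ ^ 2 = ‖φ E‖ ^ 2 / W E * (- W E) := by field_simp
    rw [h3]
    exact mul_le_mul_of_nonneg_left h2 (by positivity)
  have hi1 : IntegrableOn (fun z => ‖φ z‖ ^ 2 * (‖deriv p z‖ ^ 2 / W z + ‖G z‖ ^ 2 / W z ^ 2))
      (ball 0 1) := integrableOn_ball_of_continuousOn <|
    (hcφ.norm.pow 2).mul (((hcp'.norm.pow 2).div hcW hW0).add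
      ((hcG.norm.pow 2).div (hcW.pow 2) fun z hz => pow_ne_zero 2 (hW0 z hz)))
  have hi2 : IntegrableOn (fun z => ‖deriv φ z‖ ^ 2) (ball 0 1) :=
    integrableOn_ball_of_continuousOn (hcφ'.norm.pow 2)
  have hi3 : IntegrableOn (dbarTwo X) (ball 0 1) := integrableOn_ball_of_continuousOn hcont
  have hi4 : IntegrableOn (fun z => (dbarTwo X z).re) (ball 0 1) := hi3.re
  calc _ ≤ ∫ z in ball (0 : ℂ) 1, (4 * ‖deriv φ z‖ ^ 2 - 2 * (dbarTwo X z).re) :=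
        setIntegral_mono_on hi1 (Integrable.sub (hi2.const_mul 4) (hi4.const_mul 2))
          measurableSet_ball fun z hz => hbound z (ball_subset_closedBall hz)
    _ = 4 * (∫ z in ball (0 : ℂ) 1, ‖deriv φ z‖ ^ 2) -
        2 * (∫ z in ball (0 : ℂ) 1, dbarTwo X z).re := by
        have hcomm := Complex.reCLM.integral_comp_comm hi3
        simp only [reCLM_apply] at hcomm
        rw [integral_sub (hi2.const_mul 4) (hi4.const_mul 2), integral_const_mul,
          integral_const_mul, hcomm]
    _ ≤ _ := by rw [hgreen]; linarith

/-- Under the hypotheses of `hardy_inequality`, multiplication by `q / V` is bounded from the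
Dirichlet norm to the Dirichlet seminorm, with an absolute constant, as soon as `|q|² ≤ |V|` and
`|q'| ≤ |p'|`. -/
theorem dirichlet_bound_div_mul {p q V φ : ℂ → ℂ} (hp : Differentiable ℂ p)
    (hq : Differentiable ℂ q) (hV : Differentiable ℂ V) (hφ : Differentiable ℂ φ)
    (hW1 : ∀ z ∈ closedBall (0 : ℂ) 1, 1 ≤ (V z).re - ‖p z‖ ^ 2)
    (hbd : ∀ z : ℂ, ‖z‖ = 1 →
      - ((V z).re - ‖p z‖ ^ 2) ≤ (z * (deriv V z - 2 * (deriv p z * conj (p z)))).re)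
    (hqV : ∀ z ∈ closedBall (0 : ℂ) 1, ‖q z‖ ^ 2 ≤ ‖V z‖)
    (hqp : ∀ z, ‖deriv q z‖ ≤ ‖deriv p z‖) :
    IntegrableOn (fun z => ‖deriv (fun w => q w / V w * φ w) z‖ ^ 2) (ball 0 1) ∧
    ∫ z in ball (0 : ℂ) 1, ‖deriv (fun w => q w / V w * φ w) z‖ ^ 2 ≤
      146 * ((∫ z in ball (0 : ℂ) 1, ‖deriv φ z‖ ^ 2) +
        ∫ θ in (-Real.pi)..Real.pi, ‖φ (exp (θ * I))‖ ^ 2) := by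
  set W : ℂ → ℝ := fun z => (V z).re - ‖p z‖ ^ 2 with hWdef
  set G : ℂ → ℂ := fun z => deriv V z - 2 * (deriv p z * conj (p z)) with hGdef
  have hardy := hardy_inequality hp hV hφ (W := W) (G := G) (fun _ => rfl) (fun _ => rfl) hW1 hbd
  have hcp := hp.continuous
  have hcV := hV.continuous
  have hcq := hq.continuous
  have hcφ := hφ.continuous
  have hcp' := hp.deriv.continuous
  have hcV' := hV.deriv.continuous
  have hcq' := hq.deriv.continuous
  have hcφ' := hφ.deriv.continuous
  have hcW : Continuous W := by simp only [hWdef]; fun_prop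
  have hcG : Continuous G := by
    simp only [hGdef]
    exact hcV'.sub (continuous_const.mul (hcp'.mul (continuous_conj.comp hcp)))
  have hVW : ∀ z ∈ closedBall (0 : ℂ) 1, W z + ‖p z‖ ^ 2 ≤ ‖V z‖ := fun z _ => by
    have := re_le_norm (V z)
    simp only [hWdef]; linarith
  have hv1 : ∀ z ∈ closedBall (0 : ℂ) 1, 1 ≤ ‖V z‖ := fun z hz => by
    have h1 : 1 ≤ W z := hW1 z hz
    nlinarith [hVW z hz, sq_nonneg ‖p z‖]
  have hV0 : ∀ z ∈ closedBall (0 : ℂ) 1, V z ≠ 0 := fun z hz => by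
    rw [← norm_pos_iff]; linarith [hv1 z hz]
  have hW0 : ∀ z ∈ closedBall (0 : ℂ) 1, W z ≠ 0 := fun z hz => by
    have h1 : 1 ≤ W z := hW1 z hz
    linarith
  set D : ℂ → ℂ := fun z => (deriv q z * V z - q z * deriv V z) / V z ^ 2 * φ z +
    q z / V z * deriv φ z with hD
  have hderiv : ∀ z ∈ closedBall (0 : ℂ) 1, deriv (fun w => q w / V w * φ w) z = D z :=
    fun z hz => (((hq z).hasDerivAt.div (hV z).hasDerivAt (hV0 z hz)).mul (hφ z).hasDerivAt).deriv
  have hDc : ContinuousOn D (closedBall 0 1) := by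
    simp only [hD]
    refine ContinuousOn.add (ContinuousOn.mul (ContinuousOn.div (by fun_prop) (by fun_prop)
      fun z hz => pow_ne_zero 2 (hV0 z hz)) (by fun_prop))
      (ContinuousOn.mul (ContinuousOn.div (by fun_prop) (by fun_prop) hV0) (by fun_prop))
  have hbound : ∀ z ∈ closedBall (0 : ℂ) 1, ‖D z‖ ^ 2 ≤ 2 * ‖deriv φ z‖ ^ 2 +
      36 * (‖φ z‖ ^ 2 * (‖deriv p z‖ ^ 2 / W z + ‖G z‖ ^ 2 / W z ^ 2)) := fun z hz => by
    have h1 : 1 ≤ W z := hW1 z hz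
    have hv := hv1 z hz
    have hWv : W z ≤ ‖V z‖ := by nlinarith [hVW z hz, sq_nonneg ‖p z‖]
    have hpv : ‖p z‖ ^ 2 ≤ ‖V z‖ := by linarith [hVW z hz]
    have hqv := hqV z hz
    have hqv1 : ‖q z‖ ≤ ‖V z‖ := by nlinarith [norm_nonneg (q z)]
    have hqpv : ‖q z‖ * ‖p z‖ ≤ ‖V z‖ := by nlinarith [sq_nonneg (‖q z‖ - ‖p z‖)]
    have hV'n : ‖deriv V z‖ ≤ ‖G z‖ + 2 * (‖deriv p z‖ * ‖p z‖) := by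
      have : deriv V z = G z + 2 * (deriv p z * conj (p z)) := by simp only [hGdef]; ring
      rw [this]
      refine (norm_add_le _ _).trans (le_of_eq ?_)
      simp
    have hvp : 0 < ‖V z‖ := by linarith
    have hA : ‖(deriv q z * V z - q z * deriv V z) / V z ^ 2‖ ≤
        (3 * ‖deriv p z‖ + ‖G z‖) / ‖V z‖ := by
      rw [norm_div, norm_pow, div_le_div_iff₀ (by positivity) hvp]
      have e1 : ‖deriv q z * V z - q z * deriv V z‖ ≤ (3 * ‖deriv p z‖ + ‖G z‖) * ‖V z‖ := by
        refine (norm_sub_le _ _).trans ?_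
        rw [norm_mul, norm_mul]
        have e2 : ‖deriv q z‖ * ‖V z‖ ≤ ‖deriv p z‖ * ‖V z‖ :=
          mul_le_mul_of_nonneg_right (hqp z) hvp.le
        have e3 : ‖q z‖ * ‖deriv V z‖ ≤ ‖q z‖ * (‖G z‖ + 2 * (‖deriv p z‖ * ‖p z‖)) :=
          mul_le_mul_of_nonneg_left hV'n (norm_nonneg _)
        have e4 : ‖q z‖ * ‖G z‖ ≤ ‖V z‖ * ‖G z‖ :=
          mul_le_mul_of_nonneg_right hqv1 (norm_nonneg _)
        have e5 : ‖deriv p z‖ * (‖q z‖ * ‖p z‖) ≤ ‖deriv p z‖ * ‖V z‖ :=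
          mul_le_mul_of_nonneg_left hqpv (norm_nonneg _)
        nlinarith
      nlinarith
    have hB : ‖q z / V z‖ ≤ 1 := by
      rw [norm_div]; exact div_le_one_of_le₀ hqv1 hvp.le
    have hDn : ‖D z‖ ≤ (3 * ‖deriv p z‖ + ‖G z‖) / ‖V z‖ * ‖φ z‖ + ‖deriv φ z‖ := by
      refine (norm_add_le _ _).trans (add_le_add ?_ ?_)
      · rw [norm_mul]; exact mul_le_mul_of_nonneg_right hA (norm_nonneg _)
      · rw [norm_mul]; exact mul_le_of_le_one_left (norm_nonneg _) hB
    have hK : ((3 * ‖deriv p z‖ + ‖G z‖) / ‖V z‖) ^ 2 ≤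
        18 * (‖deriv p z‖ ^ 2 / W z + ‖G z‖ ^ 2 / W z ^ 2) := by
      have e1 : ‖deriv p z‖ ^ 2 / ‖V z‖ ^ 2 ≤ ‖deriv p z‖ ^ 2 / W z :=
        div_le_div_of_nonneg_left (by positivity) (by linarith) (by nlinarith)
      have e2 : ‖G z‖ ^ 2 / ‖V z‖ ^ 2 ≤ ‖G z‖ ^ 2 / W z ^ 2 :=
        div_le_div_of_nonneg_left (by positivity) (by positivity) (by nlinarith)
      have e3 : ((3 * ‖deriv p z‖ + ‖G z‖) / ‖V z‖) ^ 2 ≤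
          18 * (‖deriv p z‖ ^ 2 / ‖V z‖ ^ 2) + 2 * (‖G z‖ ^ 2 / ‖V z‖ ^ 2) := by
        rw [div_pow, ← mul_div_assoc, ← mul_div_assoc, ← add_div]
        gcongr
        nlinarith [sq_nonneg (3 * ‖deriv p z‖ - ‖G z‖)]
      have e4 : 0 ≤ ‖G z‖ ^ 2 / ‖V z‖ ^ 2 := by positivity
      linarith
    set K := (3 * ‖deriv p z‖ + ‖G z‖) / ‖V z‖
    calc ‖D z‖ ^ 2 ≤ (K * ‖φ z‖ + ‖deriv φ z‖) ^ 2 := by gcongr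
      _ ≤ 2 * ‖deriv φ z‖ ^ 2 + 2 * (‖φ z‖ ^ 2 * K ^ 2) := by
        nlinarith [sq_nonneg (K * ‖φ z‖ - ‖deriv φ z‖)]
      _ ≤ _ := by
        have := mul_le_mul_of_nonneg_left hK (sq_nonneg ‖φ z‖)
        nlinarith
  have hi : IntegrableOn (fun z => ‖D z‖ ^ 2) (ball 0 1) :=
    integrableOn_ball_of_continuousOn (hDc.norm.pow 2)
  have hi1 : IntegrableOn (fun z => ‖φ z‖ ^ 2 * (‖deriv p z‖ ^ 2 / W z + ‖G z‖ ^ 2 / W z ^ 2))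
      (ball 0 1) := integrableOn_ball_of_continuousOn <|
    (hcφ.continuousOn.norm.pow 2).mul (((hcp'.continuousOn.norm.pow 2).div hcW.continuousOn
      hW0).add ((hcG.continuousOn.norm.pow 2).div (hcW.continuousOn.pow 2)
        fun z hz => pow_ne_zero 2 (hW0 z hz)))
  have hi2 : IntegrableOn (fun z => ‖deriv φ z‖ ^ 2) (ball 0 1) :=
    integrableOn_ball_of_continuousOn (hcφ'.continuousOn.norm.pow 2)
  have heq : EqOn (fun z => ‖deriv (fun w => q w / V w * φ w) z‖ ^ 2) (fun z => ‖D z‖ ^ 2)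
      (ball 0 1) := fun z hz => by simp only [hderiv z (ball_subset_closedBall hz)]
  refine ⟨hi.congr_fun heq.symm measurableSet_ball, ?_⟩
  rw [setIntegral_congr_fun measurableSet_ball heq]
  have hT : 0 ≤ ∫ θ in (-Real.pi)..Real.pi, ‖φ (exp (θ * I))‖ ^ 2 :=
    intervalIntegral.integral_nonneg (by linarith [Real.pi_pos]) fun _ _ => by positivity
  calc _ ≤ ∫ z in ball (0 : ℂ) 1, (2 * ‖deriv φ z‖ ^ 2 +
      36 * (‖φ z‖ ^ 2 * (‖deriv p z‖ ^ 2 / W z + ‖G z‖ ^ 2 / W z ^ 2))) :=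
        setIntegral_mono_on hi (Integrable.fun_add (hi2.const_mul 2) (hi1.const_mul 36))
          measurableSet_ball fun z hz => hbound z (ball_subset_closedBall hz)
    _ = 2 * (∫ z in ball (0 : ℂ) 1, ‖deriv φ z‖ ^ 2) + 36 * ∫ z in ball (0 : ℂ) 1,
          (‖φ z‖ ^ 2 * (‖deriv p z‖ ^ 2 / W z + ‖G z‖ ^ 2 / W z ^ 2)) := by
        rw [integral_add (hi2.const_mul 2) (hi1.const_mul 36), integral_const_mul,
          integral_const_mul]
    _ ≤ _ := by linarith

/-- The real quadratic form `∑ κ(n, m) Re (bₙ conj bₘ)`, summed over `n, m < N`. -/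
noncomputable def kernelForm (N : ℕ) (κ : ℕ → ℕ → ℝ) (b : ℕ → ℂ) : ℝ :=
  ∑ n ∈ Finset.range N, ∑ m ∈ Finset.range N, κ n m * (b n * conj (b m)).re

theorem kernelForm_congr {N : ℕ} {κ κ' : ℕ → ℕ → ℝ} {b : ℕ → ℂ}
    (h : ∀ n < N, ∀ m < N, κ n m = κ' n m) : kernelForm N κ b = kernelForm N κ' b :=
  Finset.sum_congr rfl fun n hn => Finset.sum_congr rfl fun m hm => by
    rw [h n (Finset.mem_range.1 hn) m (Finset.mem_range.1 hm)]

theorem kernelForm_add (N : ℕ) (κ κ' : ℕ → ℕ → ℝ) (b : ℕ → ℂ) :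
    kernelForm N (fun n m => κ n m + κ' n m) b = kernelForm N κ b + kernelForm N κ' b := by
  simp only [kernelForm, add_mul, Finset.sum_add_distrib]

theorem kernelForm_const_mul (N : ℕ) (c : ℝ) (κ : ℕ → ℕ → ℝ) (b : ℕ → ℂ) :
    kernelForm N (fun n m => c * κ n m) b = c * kernelForm N κ b := by
  simp only [kernelForm, mul_assoc, Finset.mul_sum]

theorem kernelForm_sum {ι : Type*} (N : ℕ) (s : Finset ι) (κ : ι → ℕ → ℕ → ℝ) (b : ℕ → ℂ) :
    kernelForm N (fun n m => ∑ i ∈ s, κ i n m) b = ∑ i ∈ s, kernelForm N (κ i) b := by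
  simp only [kernelForm, Finset.sum_mul]
  rw [Finset.sum_comm]
  simp_rw [Finset.sum_comm (s := s)]
  rw [Finset.sum_comm]

theorem kernelForm_mul_mul (N : ℕ) (κ : ℕ → ℕ → ℝ) (c : ℕ → ℝ) (b : ℕ → ℂ) :
    kernelForm N (fun n m => c n * c m * κ n m) b = kernelForm N κ (fun n => c n * b n) := by
  refine Finset.sum_congr rfl fun n _ => Finset.sum_congr rfl fun m _ => ?_
  have : (c n * b n) * conj (c m * b m) = ((c n * c m : ℝ) : ℂ) * (b n * conj (b m)) := by
    simp only [map_mul, conj_ofReal]; push_cast; ring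
  rw [this, re_ofReal_mul]; ring

theorem kernelForm_one (N : ℕ) (b : ℕ → ℂ) :
    kernelForm N (fun _ _ => 1) b = ‖∑ n ∈ Finset.range N, b n‖ ^ 2 := by
  have h : ((‖∑ n ∈ Finset.range N, b n‖ ^ 2 : ℝ) : ℂ) =
      ∑ n ∈ Finset.range N, ∑ m ∈ Finset.range N, b n * conj (b m) := by
    rw [ofReal_pow, ← mul_conj', map_sum, Finset.sum_mul_sum]
  rw [← ofReal_re (‖∑ n ∈ Finset.range N, b n‖ ^ 2), h]
  simp [kernelForm, re_sum]

theorem kernelForm_rankOne (N : ℕ) (c : ℕ → ℝ) (b : ℕ → ℂ) :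
    kernelForm N (fun n m => c n * c m) b = ‖∑ n ∈ Finset.range N, c n * b n‖ ^ 2 := by
  have := kernelForm_mul_mul N (fun _ _ => 1) c b
  simpa only [mul_one, kernelForm_one] using this

theorem pow_dist_eq_sum (t : ℝ) (n m : ℕ) : t ^ n.dist m = t ^ n * t ^ m + (1 - t ^ 2) *
    ∑ i ∈ Finset.range (min n m), t ^ (n - 1 - i) * t ^ (m - 1 - i) := by
  wlog h : n ≤ m generalizing n m
  · rw [Nat.dist_comm, this m n (by omega), min_comm, mul_comm (t ^ m)]
    simp only [mul_comm (t ^ (m - 1 - _))]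
  obtain ⟨k, rfl⟩ := Nat.exists_eq_add_of_le h
  rw [Nat.dist_eq_sub_of_le h, min_eq_left h, Nat.add_sub_cancel_left]
  clear h
  induction n with
  | zero => simp
  | succ n ih =>
    rw [Finset.sum_range_succ']
    have h1 : ∀ i ∈ Finset.range n, t ^ (n + 1 - 1 - (i + 1)) * t ^ (n + 1 + k - 1 - (i + 1)) =
        t ^ (n - 1 - i) * t ^ (n + k - 1 - i) := fun i _ => by
      congr 2 <;> omega
    have h2 : n + 1 + k - 1 - 0 = n + k := by omega
    rw [Finset.sum_congr rfl h1, h2, Nat.add_sub_cancel, Nat.sub_zero]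
    calc t ^ k = _ := ih
      _ = _ := by ring

theorem sum_range_min_eq {N n m : ℕ} (hn : n < N) (g : ℕ → ℝ) :
    ∑ i ∈ Finset.range (min n m), g i =
      ∑ i ∈ Finset.range N, (if i < n then 1 else 0) * (if i < m then 1 else 0) * g i := by
  have : Finset.range (min n m) = (Finset.range N).filter (fun i => i < n ∧ i < m) := by
    ext i; simp; omega
  rw [this, Finset.sum_filter]
  refine Finset.sum_congr rfl fun i _ => ?_
  by_cases h1 : i < n <;> by_cases h2 : i < m <;> simp [h1, h2]

theorem kernelForm_pow_dist_sub_nonneg (N : ℕ) {t : ℝ} (h0 : 0 ≤ t) (h1 : t ≤ 1) (b : ℕ → ℂ) :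
    0 ≤ kernelForm N (fun n m => t ^ n.dist m - t ^ n * t ^ m) b := by
  have h : kernelForm N (fun n m => t ^ n.dist m - t ^ n * t ^ m) b =
      kernelForm N (fun n m => (1 - t ^ 2) * ∑ i ∈ Finset.range N,
        ((if i < n then 1 else 0) * t ^ (n - 1 - i)) *
          ((if i < m then 1 else 0) * t ^ (m - 1 - i))) b := by
    refine kernelForm_congr fun n hn m _ => ?_
    rw [pow_dist_eq_sum, sum_range_min_eq hn, add_sub_cancel_left]
    congr 1
    exact Finset.sum_congr rfl fun i _ => by ring
  rw [h, kernelForm_const_mul, kernelForm_sum]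
  refine mul_nonneg (by nlinarith) (Finset.sum_nonneg fun i _ => ?_)
  have := kernelForm_rankOne N (fun n => (if i < n then 1 else 0) * t ^ (n - 1 - i)) b
  rw [this]
  positivity

theorem kernelForm_pow_dist_nonneg (N : ℕ) {t : ℝ} (h0 : 0 ≤ t) (h1 : t ≤ 1) (b : ℕ → ℂ) :
    0 ≤ kernelForm N (fun n m => t ^ n.dist m) b := by
  have h := kernelForm_pow_dist_sub_nonneg N h0 h1 b
  have h2 := kernelForm_add N (fun n m => t ^ n.dist m - t ^ n * t ^ m)
    (fun n m => t ^ n * t ^ m) b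
  simp only [sub_add_cancel] at h2
  rw [h2, kernelForm_rankOne]
  positivity

theorem kernelForm_pow_dist_div_nonneg (N : ℕ) {r : ℝ} (h0 : 0 ≤ r) (h1 : r ≤ 1) (b : ℕ → ℂ) :
    0 ≤ kernelForm N (fun n m => r ^ n.dist m / (n.dist m + 1)) b := by
  have h : kernelForm N (fun n m => r ^ n.dist m / (n.dist m + 1)) b =
      ∫ s in (0 : ℝ)..1, kernelForm N (fun n m => (s * r) ^ n.dist m) b := by
    simp only [kernelForm]
    rw [intervalIntegral.integral_finsetSum fun n _ =>
      Continuous.intervalIntegrable (by fun_prop) _ _]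
    refine Finset.sum_congr rfl fun n _ => ?_
    rw [intervalIntegral.integral_finsetSum fun m _ =>
      Continuous.intervalIntegrable (by fun_prop) _ _]
    refine Finset.sum_congr rfl fun m _ => ?_
    simp only [mul_pow, mul_assoc]
    rw [intervalIntegral.integral_mul_const, integral_pow]
    simp
    ring
  rw [h]
  exact intervalIntegral.integral_nonneg zero_le_one fun s hs =>
    kernelForm_pow_dist_nonneg N (mul_nonneg hs.1 h0) (mul_le_one₀ hs.2 h0 h1) b

/-- The kernel `(n + m + 1) r^|n - m| / (|n - m| + 1) - r^(n + m)` is positive semidefinite. -/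
theorem kernelForm_sarason_nonneg (N : ℕ) {r : ℝ} (h0 : 0 ≤ r) (h1 : r ≤ 1) (b : ℕ → ℂ) :
    0 ≤ kernelForm N (fun n m => (n + m + 1 : ℝ) / (n.dist m + 1) * r ^ n.dist m
      - r ^ n * r ^ m) b := by
  have h : kernelForm N (fun n m => (n + m + 1 : ℝ) / (n.dist m + 1) * r ^ n.dist m
      - r ^ n * r ^ m) b = kernelForm N (fun n m => (r ^ n.dist m - r ^ n * r ^ m) +
        2 * ∑ i ∈ Finset.range N, (if i < n then 1 else 0) * (if i < m then 1 else 0) *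
          (r ^ n.dist m / (n.dist m + 1))) b := by
    refine kernelForm_congr fun n hn m _ => ?_
    rw [← sum_range_min_eq hn, Finset.sum_const, Finset.card_range, nsmul_eq_mul]
    have hd : (n + m + 1 : ℝ) = 2 * ((min n m : ℕ) : ℝ) + (n.dist m + 1) := by
      norm_cast
      rcases le_total n m with h | h
      · rw [Nat.dist_eq_sub_of_le h, min_eq_left h]; omega
      · rw [Nat.dist_eq_sub_of_le_right h, min_eq_right h]; omega
    have hp : (n.dist m + 1 : ℝ) ≠ 0 := by positivity
    rw [hd]
    field_simp
    ring
  rw [h, kernelForm_add, kernelForm_const_mul, kernelForm_sum]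
  refine add_nonneg (kernelForm_pow_dist_sub_nonneg N h0 h1 b)
    (mul_nonneg zero_le_two (Finset.sum_nonneg fun i _ => ?_))
  rw [kernelForm_mul_mul N (fun n m => r ^ n.dist m / (n.dist m + 1))
    (fun n => if i < n then 1 else 0)]
  exact kernelForm_pow_dist_div_nonneg N h0 h1 _

/-- The weight `2`, `1` or `0` according as `n > m`, `n = m` or `n < m`. -/
noncomputable def triangularWeight (n m : ℕ) : ℝ := if m < n then 2 else if m = n then 1 else 0

theorem triangularWeight_add_swap (n m : ℕ) :
    triangularWeight n m + triangularWeight m n = 2 := by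
  unfold triangularWeight
  rcases lt_trichotomy n m with h | h | h
  · simp [h, h.ne', not_lt.2 h.le]
  · subst h; norm_num
  · simp [h, h.ne', not_lt.2 h.le]

theorem kernelForm_swap (N : ℕ) (κ : ℕ → ℕ → ℝ) (b : ℕ → ℂ) :
    kernelForm N (fun n m => κ m n) b = kernelForm N κ b := by
  rw [kernelForm, Finset.sum_comm]
  refine Finset.sum_congr rfl fun n _ => Finset.sum_congr rfl fun m _ => ?_
  rw [← conj_re (b m * _)]
  simp [mul_comm]

theorem kernelForm_triangularWeight_mul (N : ℕ) {κ : ℕ → ℕ → ℝ} (hκ : ∀ n m, κ n m = κ m n)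
    (b : ℕ → ℂ) : kernelForm N (fun n m => triangularWeight n m * κ n m) b = kernelForm N κ b := by
  have h1 := kernelForm_add N (fun n m => triangularWeight n m * κ n m)
    (fun n m => triangularWeight m n * κ m n) b
  have h2 := kernelForm_swap N (fun n m => triangularWeight n m * κ n m) b
  have h3 : kernelForm N (fun n m => triangularWeight n m * κ n m + triangularWeight m n * κ m n) b
      = 2 * kernelForm N κ b := by
    rw [← kernelForm_const_mul]
    refine kernelForm_congr fun n _ m _ => ?_
    rw [← hκ n m, ← add_mul, triangularWeight_add_swap]
  linarith

/-- The `(n, m)` term of the Sarason function of `∑ aₙ zⁿ`. -/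
noncomputable def sarasonTerm (a : ℕ → ℂ) (i : ℕ × ℕ) (z : ℂ) : ℂ :=
  a i.1 * conj (a i.2) *
    ((triangularWeight i.1 i.2 * ((i.1 + i.2 + 1 : ℝ) / (i.1.dist i.2 + 1)) : ℝ) : ℂ) *
      z ^ i.1.dist i.2

/-- The Sarason function of the polynomial `∑ n < N, aₙ zⁿ`. -/
noncomputable def sarasonPoly (a : ℕ → ℂ) (N : ℕ) (z : ℂ) : ℂ :=
  1 + ∑ i ∈ Finset.range N ×ˢ Finset.range N, sarasonTerm a i z

/-- The polynomial `∑ n < N, aₙ zⁿ`. -/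
noncomputable def coeffPoly (a : ℕ → ℂ) (N : ℕ) (z : ℂ) : ℂ := ∑ n ∈ Finset.range N, a n * z ^ n

theorem differentiable_coeffPoly (a : ℕ → ℂ) (N : ℕ) : Differentiable ℂ (coeffPoly a N) := by
  unfold coeffPoly; fun_prop

theorem differentiable_sarasonTerm (a : ℕ → ℂ) (i : ℕ × ℕ) :
    Differentiable ℂ (sarasonTerm a i) := by
  unfold sarasonTerm; fun_prop

theorem differentiable_sarasonPoly (a : ℕ → ℂ) (N : ℕ) : Differentiable ℂ (sarasonPoly a N) := by
  have := differentiable_sarasonTerm a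
  unfold sarasonPoly; fun_prop

theorem triangularWeight_mul_re (a : ℕ → ℂ) {E : ℂ} (hE : ‖E‖ = 1) (r : ℝ) (n m : ℕ) :
    triangularWeight n m * (a n * conj (a m) * (r * E) ^ n.dist m).re =
      triangularWeight n m * (r ^ n.dist m * (a n * E ^ n * conj (a m * E ^ m)).re) := by
  rcases lt_or_ge n m with h | h
  · simp [triangularWeight, h.ne', not_lt.2 h.le]
  · obtain ⟨k, rfl⟩ := Nat.exists_eq_add_of_le h
    have hEE : E * conj E = 1 := by rw [mul_conj', hE]; simp
    have hk : E ^ (m + k) * conj E ^ m = E ^ k := by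
      rw [pow_add, mul_right_comm, ← mul_pow, hEE, one_pow, one_mul]
    have : a (m + k) * E ^ (m + k) * conj (a m * E ^ m) = a (m + k) * conj (a m) * E ^ k := by
      rw [← hk, map_mul, map_pow]; ring
    rw [this, Nat.dist_eq_sub_of_le_right h, Nat.add_sub_cancel_left]
    congr 1
    rw [← re_ofReal_mul]
    congr 1
    push_cast; ring

theorem re_sum_triangularWeight_mul (a : ℕ → ℂ) (N : ℕ) {κ : ℕ → ℕ → ℝ}
    (hκ : ∀ n m, κ n m = κ m n) {E : ℂ} (hE : ‖E‖ = 1) (r : ℝ) :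
    (∑ i ∈ Finset.range N ×ˢ Finset.range N, a i.1 * conj (a i.2) *
      ((triangularWeight i.1 i.2 * κ i.1 i.2 : ℝ) : ℂ) * (r * E) ^ i.1.dist i.2).re =
      kernelForm N (fun n m => κ n m * r ^ n.dist m) (fun n => a n * E ^ n) := by
  rw [← kernelForm_triangularWeight_mul N (fun n m => by rw [hκ, Nat.dist_comm]), kernelForm,
    Finset.sum_product, re_sum]
  refine Finset.sum_congr rfl fun n _ => ?_
  rw [re_sum]
  refine Finset.sum_congr rfl fun m _ => ?_
  have h := triangularWeight_mul_re a hE r n m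
  have h1 : a n * conj (a m) * ((triangularWeight n m * κ n m : ℝ) : ℂ) * (r * E) ^ n.dist m =
      ((triangularWeight n m * κ n m : ℝ) : ℂ) * (a n * conj (a m) * (r * E) ^ n.dist m) := by
    ring
  rw [h1, re_ofReal_mul]
  linear_combination κ n m * h

theorem norm_coeffPoly_sq (a : ℕ → ℂ) (N : ℕ) (r : ℝ) (E : ℂ) :
    ‖coeffPoly a N (r * E)‖ ^ 2 =
      kernelForm N (fun n m => r ^ n * r ^ m) (fun n => a n * E ^ n) := by
  rw [kernelForm_rankOne, coeffPoly]
  congr 2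
  refine Finset.sum_congr rfl fun n _ => ?_
  push_cast; ring

theorem one_le_re_sarasonPoly_sub (a : ℕ → ℂ) (N : ℕ) {z : ℂ} (hz : z ∈ closedBall (0 : ℂ) 1) :
    1 ≤ (sarasonPoly a N z).re - ‖coeffPoly a N z‖ ^ 2 := by
  obtain ⟨r, E, hr0, hr1, hE, rfl⟩ : ∃ (r : ℝ) (E : ℂ), 0 ≤ r ∧ r ≤ 1 ∧ ‖E‖ = 1 ∧ z = r * E :=
    ⟨‖z‖, exp (z.arg * I), norm_nonneg _, by simpa using hz, norm_exp_ofReal_mul_I _,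
      (norm_mul_exp_arg_mul_I z).symm⟩
  have h := kernelForm_sarason_nonneg N hr0 hr1 (fun n => a n * E ^ n)
  have hre := re_sum_triangularWeight_mul a N
    (κ := fun n m => (n + m + 1 : ℝ) / (n.dist m + 1))
    (fun n m => by rw [Nat.dist_comm, add_comm (n : ℝ)]) hE r
  have hsub := kernelForm_add N (fun n m => (n + m + 1 : ℝ) / (n.dist m + 1) * r ^ n.dist m
      - r ^ n * r ^ m) (fun n m => r ^ n * r ^ m) (fun n => a n * E ^ n)
  simp only [sub_add_cancel] at hsub
  simp only [sarasonPoly, sarasonTerm, add_re, one_re]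
  rw [hre, norm_coeffPoly_sq, hsub]
  linarith

theorem sarasonPoly_boundary (a : ℕ → ℂ) (N : ℕ) {z : ℂ} (hz : ‖z‖ = 1) :
    - ((sarasonPoly a N z).re - ‖coeffPoly a N z‖ ^ 2) ≤
      (z * (deriv (sarasonPoly a N) z -
        2 * (deriv (coeffPoly a N) z * conj (coeffPoly a N z)))).re := by
  set b : ℕ → ℂ := fun n => a n * z ^ n with hb
  have hV : z * deriv (sarasonPoly a N) z + sarasonPoly a N z =
      1 + ∑ i ∈ Finset.range N ×ˢ Finset.range N, a i.1 * conj (a i.2) *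
        ((triangularWeight i.1 i.2 * (i.1 + i.2 + 1 : ℝ) : ℝ) : ℂ) *
          (((1 : ℝ) : ℂ) * z) ^ i.1.dist i.2 := by
    have hd : deriv (sarasonPoly a N) z =
        ∑ i ∈ Finset.range N ×ˢ Finset.range N, deriv (sarasonTerm a i) z := by
      unfold sarasonPoly
      rw [deriv_const_add, deriv_fun_sum fun i _ => differentiable_sarasonTerm a i z]
    rw [hd, sarasonPoly, Finset.mul_sum, add_left_comm, ← Finset.sum_add_distrib]
    congr 1
    refine Finset.sum_congr rfl fun i _ => ?_
    have h1 : deriv (sarasonTerm a i) z = a i.1 * conj (a i.2) *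
      ((triangularWeight i.1 i.2 * ((i.1 + i.2 + 1 : ℝ) / (i.1.dist i.2 + 1)) : ℝ) : ℂ) *
        (i.1.dist i.2 * z ^ (i.1.dist i.2 - 1)) := by
      unfold sarasonTerm
      rw [deriv_const_mul _ (by fun_prop), deriv_pow_field]
    have h2 : z * (i.1.dist i.2 * z ^ (i.1.dist i.2 - 1)) = i.1.dist i.2 * z ^ i.1.dist i.2 := by
      rcases Nat.eq_zero_or_pos (i.1.dist i.2) with h | h
      · simp [h]
      · obtain ⟨k, hk⟩ := Nat.exists_eq_add_of_lt h
        rw [hk]; simp; ring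
    have h3 : ((i.1.dist i.2 : ℂ) + 1) ≠ 0 := Nat.cast_add_one_ne_zero _
    rw [h1, mul_left_comm, h2, sarasonTerm, ofReal_one, one_mul]
    push_cast
    field_simp
  have hVre := congrArg re hV
  rw [add_re, add_re, one_re, re_sum_triangularWeight_mul a N (κ := fun n m => (n + m + 1 : ℝ))
    (fun n m => by ring) hz] at hVre
  simp only [one_pow, mul_one] at hVre
  have hp : (2 * (z * deriv (coeffPoly a N) z * conj (coeffPoly a N z))).re =
      kernelForm N (fun n m => (n + m : ℝ)) b := by
    have h1 : z * deriv (coeffPoly a N) z = ∑ n ∈ Finset.range N, n * b n := by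
      unfold coeffPoly
      rw [deriv_fun_sum fun n _ => by fun_prop, Finset.mul_sum]
      refine Finset.sum_congr rfl fun n _ => ?_
      rw [deriv_const_mul _ (by fun_prop), deriv_pow_field]
      rcases n with _ | n
      · simp
      · simp [hb]; ring
    have h2 : (z * deriv (coeffPoly a N) z * conj (coeffPoly a N z)).re =
        kernelForm N (fun n _ => (n : ℝ)) b := by
      rw [h1, coeffPoly, map_sum, Finset.sum_mul_sum, re_sum]
      refine Finset.sum_congr rfl fun n _ => ?_
      rw [re_sum]
      refine Finset.sum_congr rfl fun m _ => ?_
      rw [mul_assoc, ← ofReal_natCast, re_ofReal_mul]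
    have h3 := kernelForm_swap N (fun n _ => (n : ℝ)) b
    rw [kernelForm_add N (fun n _ => (n : ℝ)) (fun _ m => (m : ℝ)), h3, ← h2,
      ← ofReal_ofNat, re_ofReal_mul]
    ring
  have hn : ‖coeffPoly a N z‖ ^ 2 = kernelForm N (fun _ _ => 1) b := by
    rw [kernelForm_one]; rfl
  have hsum := kernelForm_add N (fun n m => (n + m : ℝ)) (fun _ _ => 1) b
  have hz : (z * (deriv (sarasonPoly a N) z -
        2 * (deriv (coeffPoly a N) z * conj (coeffPoly a N z)))).re =
      (z * deriv (sarasonPoly a N) z).re -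
        (2 * (z * deriv (coeffPoly a N) z * conj (coeffPoly a N z))).re := by
    rw [← sub_re]; congr 1; ring
  rw [hz, hp, hn]
  linarith

theorem integral_exp_natCast_sub_mul (n m : ℕ) :
    ∫ θ in (-Real.pi)..Real.pi, exp (((n : ℂ) - m) * I * θ) =
      if n = m then 2 * (Real.pi : ℂ) else 0 := by
  split_ifs with h
  · subst h
    simp
    ring
  · have hc : ((n : ℂ) - m) * I ≠ 0 :=
      mul_ne_zero (sub_ne_zero.2 (by exact_mod_cast h)) I_ne_zero
    rw [integral_exp_mul_complex hc, div_eq_zero_iff, sub_eq_zero]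
    refine Or.inl (exp_eq_exp_iff_exists_int.2 ⟨(n : ℤ) - m, ?_⟩)
    push_cast
    ring

/-- Parseval's identity for a polynomial on a circle. -/
theorem integral_norm_coeffPoly_sq (u : ℕ → ℂ) (N : ℕ) (r : ℝ) :
    ∫ θ in (-Real.pi)..Real.pi, ‖coeffPoly u N (r * exp (θ * I))‖ ^ 2 =
      2 * Real.pi * ∑ n ∈ Finset.range N, ‖u n‖ ^ 2 * r ^ (2 * n) := by
  have h : ∀ θ : ℝ, ((‖coeffPoly u N (r * exp (θ * I))‖ ^ 2 : ℝ) : ℂ) =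
      ∑ n ∈ Finset.range N, ∑ m ∈ Finset.range N,
        u n * conj (u m) * r ^ (n + m) * exp (((n : ℂ) - m) * I * θ) := fun θ => by
    rw [ofReal_pow, ← mul_conj', coeffPoly, map_sum, Finset.sum_mul_sum]
    refine Finset.sum_congr rfl fun n _ => Finset.sum_congr rfl fun m _ => ?_
    have he : exp (((n : ℂ) - m) * I * θ) = exp (θ * I) ^ n * conj (exp (θ * I)) ^ m := by
      rw [← exp_conj, ← exp_nat_mul, ← exp_nat_mul, ← exp_add, map_mul, conj_I, conj_ofReal]
      congr 1
      ring
    rw [he]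
    simp only [map_mul, map_pow, conj_ofReal]
    ring
  rw [← ofReal_inj, ← intervalIntegral.integral_ofReal]
  simp only [h]
  rw [intervalIntegral.integral_finsetSum fun n _ =>
    Continuous.intervalIntegrable (by fun_prop) _ _]
  push_cast
  rw [Finset.mul_sum]
  refine Finset.sum_congr rfl fun n hn => ?_
  rw [intervalIntegral.integral_finsetSum fun m _ =>
    Continuous.intervalIntegrable (by fun_prop) _ _]
  simp only [intervalIntegral.integral_const_mul, integral_exp_natCast_sub_mul]
  rw [Finset.sum_eq_single n (fun m _ hm => by simp [hm.symm]) (fun h => absurd hn h)]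
  rw [mul_conj', if_pos rfl]
  ring

theorem setIntegral_ball_norm_coeffPoly_sq (u : ℕ → ℂ) (N : ℕ) {ρ : ℝ} (hρ : 0 ≤ ρ) :
    ∫ z in ball (0 : ℂ) ρ, ‖coeffPoly u N z‖ ^ 2 =
      Real.pi * ∑ n ∈ Finset.range N, ‖u n‖ ^ 2 / (n + 1) * ρ ^ (2 * n + 2) := by
  have hc := (differentiable_coeffPoly u N).continuous
  rw [setIntegral_ball_eq_polar hρ (by fun_prop)]
  simp only [smul_eq_mul, intervalIntegral.integral_const_mul, integral_norm_coeffPoly_sq]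
  have : ∀ r : ℝ, r * (2 * Real.pi * ∑ n ∈ Finset.range N, ‖u n‖ ^ 2 * r ^ (2 * n)) =
      ∑ n ∈ Finset.range N, 2 * Real.pi * ‖u n‖ ^ 2 * r ^ (2 * n + 1) := fun r => by
    rw [Finset.mul_sum, Finset.mul_sum]
    exact Finset.sum_congr rfl fun n _ => by ring
  simp only [this]
  rw [intervalIntegral.integral_finsetSum fun n _ =>
    Continuous.intervalIntegrable (by fun_prop) _ _, Finset.mul_sum]
  refine Finset.sum_congr rfl fun n _ => ?_
  rw [intervalIntegral.integral_const_mul, integral_pow]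
  push_cast
  field_simp
  ring

theorem deriv_coeffPoly_succ (a : ℕ → ℂ) (N : ℕ) (z : ℂ) :
    deriv (coeffPoly a (N + 1)) z = coeffPoly (fun n => (n + 1) * a (n + 1)) N z := by
  unfold coeffPoly
  rw [deriv_fun_sum fun n _ => by fun_prop, Finset.sum_range_succ']
  simp only [pow_zero, mul_one, deriv_const, add_zero]
  refine Finset.sum_congr rfl fun n _ => ?_
  rw [deriv_const_mul _ (by fun_prop), deriv_pow_field]
  push_cast [Nat.add_sub_cancel]
  ring

/-- A sequence `a` is the coefficient sequence of a function in the Dirichlet space. -/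
def DirichletSummable (a : ℕ → ℂ) : Prop := Summable fun n : ℕ => (2 * n + 1 : ℝ) * ‖a n‖ ^ 2

theorem exists_dirichlet_coeffPoly_le {a : ℕ → ℂ} (ha : DirichletSummable a) :
    ∃ C : ℝ, ∀ N, (∫ z in ball (0 : ℂ) 1, ‖deriv (coeffPoly a N) z‖ ^ 2) +
      ∫ θ in (-Real.pi)..Real.pi, ‖coeffPoly a N (exp (θ * I))‖ ^ 2 ≤ C := by
  set S := ∑' n : ℕ, (2 * n + 1 : ℝ) * ‖a n‖ ^ 2 with hS
  have hle : ∀ N, ∑ n ∈ Finset.range N, (2 * n + 1 : ℝ) * ‖a n‖ ^ 2 ≤ S := fun N =>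
    ha.sum_le_tsum _ fun n _ => by positivity
  refine ⟨Real.pi * S + 2 * Real.pi * S, fun N => add_le_add ?_ ?_⟩
  · rcases N with _ | N
    · have h0 : coeffPoly a 0 = fun _ => 0 := by ext; simp [coeffPoly]
      have : 0 ≤ S := by simpa using hle 0
      simp only [h0, deriv_const]
      simp
      positivity
    · simp only [deriv_coeffPoly_succ]
      rw [setIntegral_ball_norm_coeffPoly_sq _ _ zero_le_one]
      refine mul_le_mul_of_nonneg_left (le_trans ?_ (hle (N + 1))) Real.pi_pos.le
      rw [Finset.sum_range_succ']
      refine le_add_of_le_of_nonneg (Finset.sum_le_sum fun n _ => ?_) (by positivity)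
      have : ‖(n + 1 : ℂ)‖ = n + 1 := by exact_mod_cast norm_natCast (n + 1)
      rw [norm_mul, this, one_pow, mul_one, mul_pow, div_le_iff₀ (by positivity)]
      push_cast
      have h1 := mul_nonneg (mul_nonneg (n.cast_nonneg (α := ℝ)) (n.cast_add_one_pos (α := ℝ)).le)
        (sq_nonneg ‖a (n + 1)‖)
      have h2 := mul_nonneg (n.cast_add_one_pos (α := ℝ)).le (sq_nonneg ‖a (n + 1)‖)
      nlinarith
  · have := integral_norm_coeffPoly_sq a N 1
    simp only [ofReal_one, one_mul, one_pow, mul_one] at this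
    rw [this]
    refine mul_le_mul_of_nonneg_left (le_trans (Finset.sum_le_sum fun n _ => ?_) (hle N))
      (by positivity)
    have h1 : (1 : ℝ) ≤ 2 * n + 1 := by linarith [n.cast_nonneg (α := ℝ)]
    exact le_mul_of_one_le_left (sq_nonneg _) h1

/-- If `F` is the sum of a power series on the unit disk and `|F|²` is integrable there, then
`∑ |uₙ|² / (n + 1)` converges. -/
theorem summable_norm_sq_div_of_integrableOn {u : ℕ → ℂ} {F : ℂ → ℂ}
    (hF : ∀ z ∈ ball (0 : ℂ) 1, HasSum (fun n => u n * z ^ n) (F z))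
    (hint : IntegrableOn (fun z => ‖F z‖ ^ 2) (ball 0 1)) :
    Summable fun n => ‖u n‖ ^ 2 / ((n : ℝ) + 1) := by
  have key : ∀ N, ∀ ρ ∈ Ioo (0 : ℝ) 1,
      Real.pi * ∑ n ∈ Finset.range N, ‖u n‖ ^ 2 / (n + 1) * ρ ^ (2 * n + 2) ≤
        ∫ z in ball (0 : ℂ) 1, ‖F z‖ ^ 2 := fun N ρ hρ => by
    have hsum : Summable fun n => ‖u n‖ * ρ ^ n := by
      have := (hF ρ (by simp [abs_of_pos hρ.1, hρ.2])).summable.norm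
      simpa [abs_of_pos hρ.1] using this
    have hM : ∀ K, ∀ z ∈ ball (0 : ℂ) ρ, ‖coeffPoly u K z‖ ≤ ∑' n, ‖u n‖ * ρ ^ n :=
      fun K z hz => by
      refine (norm_sum_le _ _).trans (le_trans (Finset.sum_le_sum fun n _ => ?_)
        (hsum.sum_le_tsum (Finset.range K) fun n _ => by have := hρ.1; positivity))
      rw [norm_mul, norm_pow]
      have : ‖z‖ ≤ ρ := (mem_ball_zero_iff.1 hz).le
      gcongr
    have hsub : ball (0 : ℂ) ρ ⊆ ball 0 1 := ball_subset_ball hρ.2.le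
    have htend : Filter.Tendsto (fun K => ∫ z in ball (0 : ℂ) ρ, ‖coeffPoly u K z‖ ^ 2)
        Filter.atTop (nhds (∫ z in ball (0 : ℂ) ρ, ‖F z‖ ^ 2)) := by
      refine tendsto_integral_of_dominated_convergence
        (fun _ => (∑' n, ‖u n‖ * ρ ^ n) ^ 2) (fun K => ?_) ?_ (fun K => ?_) ?_
      · have := (differentiable_coeffPoly u K).continuous
        exact Continuous.aestronglyMeasurable (by fun_prop)
      · exact integrableOn_const measure_ball_lt_top.ne
      · refine (ae_restrict_mem measurableSet_ball).mono fun z hz => ?_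
        rw [Real.norm_of_nonneg (by positivity)]
        have := hM K z hz
        gcongr
      · refine (ae_restrict_mem measurableSet_ball).mono fun z hz => ?_
        exact ((hF z (hsub hz)).tendsto_sum_nat.norm).pow 2
    refine le_trans (ge_of_tendsto htend ?_)
      (setIntegral_mono_set hint (ae_of_all _ fun z => by positivity) hsub.eventuallyLE)
    filter_upwards [Filter.eventually_ge_atTop N] with K hK
    rw [setIntegral_ball_norm_coeffPoly_sq u K hρ.1.le]
    refine mul_le_mul_of_nonneg_left (Finset.sum_le_sum_of_subset_of_nonneg
      (Finset.range_subset_range.2 hK) fun n _ _ => ?_) Real.pi_pos.le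
    have := hρ.1
    positivity
  refine summable_of_sum_range_le (c := (∫ z in ball (0 : ℂ) 1, ‖F z‖ ^ 2) / Real.pi)
    (fun n => by positivity) fun N => ?_
  rw [le_div_iff₀' Real.pi_pos]
  have hlim : Filter.Tendsto (fun ρ : ℝ =>
      Real.pi * ∑ n ∈ Finset.range N, ‖u n‖ ^ 2 / (n + 1) * ρ ^ (2 * n + 2))
      (nhdsWithin 1 (Iio 1)) (nhds (Real.pi * ∑ n ∈ Finset.range N, ‖u n‖ ^ 2 / (n + 1))) := by
    have : Continuous (fun ρ : ℝ =>
      Real.pi * ∑ n ∈ Finset.range N, ‖u n‖ ^ 2 / (n + 1) * ρ ^ (2 * n + 2)) := by fun_prop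
    simpa using (this.tendsto 1).mono_left nhdsWithin_le_nhds
  refine le_of_tendsto hlim ?_
  filter_upwards [Ioo_mem_nhdsLT (zero_lt_one' ℝ)] with ρ hρ using key N ρ hρ

/-- A function in the Dirichlet space is the sum of a power series with Dirichlet-summable
coefficients. -/
theorem MemDirichlet.exists_hasSum {f : ℂ → ℂ} (hf : MemDirichlet f) :
    ∃ a : ℕ → ℂ, DirichletSummable a ∧
      ∀ z ∈ ball (0 : ℂ) 1, HasSum (fun n => a n * z ^ n) (f z) := by
  obtain ⟨a, ha⟩ : ∃ a : ℕ → ℂ, ∀ n, a n = (n.factorial : ℂ)⁻¹ * iteratedDeriv n f 0 :=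
    ⟨_, fun _ => rfl⟩
  have hsum : ∀ z ∈ ball (0 : ℂ) 1, HasSum (fun n => a n * z ^ n) (f z) := fun z hz => by
    refine (hasSum_taylorSeries_on_ball hf.1 hz).congr_fun fun n => ?_
    simp only [ha, smul_eq_mul, sub_zero]
    ring
  have hsum' : ∀ z ∈ ball (0 : ℂ) 1,
      HasSum (fun n : ℕ => (n + 1) * a (n + 1) * z ^ n) (deriv f z) := fun z hz => by
    refine (hasSum_taylorSeries_on_ball (hf.1.deriv isOpen_ball) hz).congr_fun fun n => ?_
    simp only [ha, smul_eq_mul, sub_zero, ← iteratedDeriv_succ', Nat.factorial_succ]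
    have : (n : ℂ) + 1 ≠ 0 := Nat.cast_add_one_ne_zero n
    push_cast
    field_simp
  refine ⟨a, ?_, hsum⟩
  have h := summable_norm_sq_div_of_integrableOn hsum' hf.2
  refine (summable_nat_add_iff 1).1 (Summable.of_nonneg_of_le (fun n => by positivity)
    (fun n => ?_) (h.mul_left 3))
  have hn : ‖(n + 1 : ℂ)‖ = n + 1 := by exact_mod_cast norm_natCast (n + 1)
  rw [norm_mul _ (a (n + 1)), hn, mul_pow, ← mul_div_assoc, le_div_iff₀ (by positivity)]
  push_cast
  nlinarith [mul_nonneg (mul_nonneg (n.cast_nonneg (α := ℝ)) (n.cast_add_one_pos (α := ℝ)).le)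
        (sq_nonneg ‖a (n + 1)‖)]

theorem tendstoLocallyUniformlyOn_unit_ball {F : ℕ → ℂ → ℂ} {f : ℂ → ℂ}
    (h : ∀ ρ ∈ Ioo (0 : ℝ) 1, TendstoUniformlyOn F f Filter.atTop (ball 0 ρ)) :
    TendstoLocallyUniformlyOn F f Filter.atTop (ball 0 1) := by
  refine tendstoLocallyUniformlyOn_of_forall_exists_nhds fun x hx => ?_
  obtain ⟨ρ, h1, h2⟩ := exists_between (mem_ball_zero_iff.1 hx)
  exact ⟨ball 0 ρ, mem_nhdsWithin_of_mem_nhds (isOpen_ball.mem_nhds (mem_ball_zero_iff.2 h1)),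
    h ρ ⟨(norm_nonneg x).trans_lt h1, h2⟩⟩

theorem tendstoLocallyUniformlyOn_coeffPoly {a : ℕ → ℂ} {f : ℂ → ℂ}
    (hf : ∀ z ∈ ball (0 : ℂ) 1, HasSum (fun n => a n * z ^ n) (f z)) :
    TendstoLocallyUniformlyOn (coeffPoly a) f Filter.atTop (ball 0 1) := by
  refine tendstoLocallyUniformlyOn_unit_ball fun ρ hρ => ?_
  have hsum : Summable fun n => ‖a n‖ * ρ ^ n := by
    have := (hf ρ (by simp [abs_of_pos hρ.1, hρ.2])).summable.norm
    simpa [abs_of_pos hρ.1] using this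
  refine (tendstoUniformlyOn_tsum_nat (f := fun n z => a n * z ^ n) hsum
    fun n z hz => ?_).congr_right fun z hz => ?_
  · rw [norm_mul, norm_pow]
    have : ‖z‖ ≤ ρ := (mem_ball_zero_iff.1 hz).le
    gcongr
  · exact (hf z (ball_subset_ball hρ.2.le hz)).tsum_eq

theorem norm_sarasonTerm_le (a : ℕ → ℂ) (i : ℕ × ℕ) {z : ℂ} {ρ : ℝ} (hz : ‖z‖ ≤ ρ) :
    ‖sarasonTerm a i z‖ ≤ (2 * i.1 + 1 : ℝ) * ‖a i.1‖ ^ 2 * ρ ^ i.1.dist i.2 +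
      (2 * i.2 + 1 : ℝ) * ‖a i.2‖ ^ 2 * ρ ^ i.1.dist i.2 := by
  obtain ⟨n, m⟩ := i
  simp only [sarasonTerm]
  have hw0 : 0 ≤ triangularWeight n m := by unfold triangularWeight; split_ifs <;> norm_num
  have hw2 : triangularWeight n m ≤ 2 := by unfold triangularWeight; split_ifs <;> norm_num
  set k : ℝ := (n + m + 1 : ℝ) / (n.dist m + 1) with hk
  have hk0 : 0 ≤ k := by positivity
  have hkn : k ≤ 2 * n + 1 ∧ k ≤ 2 * m + 1 := by
    rw [hk, div_le_iff₀ (by positivity), div_le_iff₀ (by positivity)]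
    rcases le_total n m with h | h
    · obtain ⟨l, rfl⟩ := Nat.exists_eq_add_of_le h
      rw [Nat.dist_eq_sub_of_le h, Nat.add_sub_cancel_left]
      norm_cast
      constructor <;> nlinarith [Nat.zero_le (n * l), Nat.zero_le (l * l)]
    · obtain ⟨l, rfl⟩ := Nat.exists_eq_add_of_le h
      rw [Nat.dist_eq_sub_of_le_right h, Nat.add_sub_cancel_left]
      norm_cast
      constructor <;> nlinarith [Nat.zero_le (m * l), Nat.zero_le (l * l)]
  rw [norm_mul, norm_mul, norm_mul, norm_pow, RCLike.norm_conj, norm_real,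
    Real.norm_of_nonneg (mul_nonneg hw0 hk0), ← add_mul]
  have hρ : ‖z‖ ^ n.dist m ≤ ρ ^ n.dist m := by gcongr
  refine mul_le_mul ?_ hρ (by positivity) (by positivity)
  have hx := sq_nonneg ‖a n‖
  have hy := sq_nonneg ‖a m‖
  calc ‖a n‖ * ‖a m‖ * (triangularWeight n m * k) ≤ ‖a n‖ * ‖a m‖ * (2 * k) := by gcongr
    _ ≤ k * ‖a n‖ ^ 2 + k * ‖a m‖ ^ 2 := by
      nlinarith [mul_nonneg hk0 (sq_nonneg (‖a n‖ - ‖a m‖))]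
    _ ≤ _ := add_le_add (mul_le_mul_of_nonneg_right hkn.1 hx)
      (mul_le_mul_of_nonneg_right hkn.2 hy)

theorem summable_mul_pow_dist {e : ℕ → ℝ} (he : Summable e) (he0 : 0 ≤ e) {ρ : ℝ}
    (hρ : ρ ∈ Ioo (0 : ℝ) 1) :
    Summable fun i : ℕ × ℕ => e i.1 * ρ ^ i.1.dist i.2 + e i.2 * ρ ^ i.1.dist i.2 := by
  have hg : Summable fun j : ℤ => ρ ^ j.natAbs := by
    have := summable_geometric_of_lt_one hρ.1.le hρ.2
    exact Summable.of_nat_of_neg (by simpa using this) (by simpa using this)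
  have hprod := he.mul_of_nonneg hg he0 fun j => pow_nonneg hρ.1.le _
  have hd : ∀ n m : ℕ, ((n : ℤ) - m).natAbs = n.dist m := fun n m => by
    unfold Nat.dist; omega
  refine Summable.add ?_ ?_
  · refine (hprod.comp_injective (i := fun i : ℕ × ℕ => (i.1, (i.1 : ℤ) - i.2))
      fun i j h => ?_).congr fun i => by simp only [Function.comp_apply, hd]
    simp only [Prod.mk.injEq] at h
    exact Prod.ext h.1 (by omega)
  · refine (hprod.comp_injective (i := fun i : ℕ × ℕ => (i.2, (i.2 : ℤ) - i.1))
      fun i j h => ?_).congr fun i => by simp only [Function.comp_apply, hd, Nat.dist_comm]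
    simp only [Prod.mk.injEq] at h
    exact Prod.ext (by omega) h.1

/-- The Sarason function of the power series `∑ aₙ zⁿ`. -/
noncomputable def sarasonFun (a : ℕ → ℂ) (z : ℂ) : ℂ := 1 + ∑' i, sarasonTerm a i z

theorem tendstoLocallyUniformlyOn_sarasonPoly {a : ℕ → ℂ} (ha : DirichletSummable a) :
    TendstoLocallyUniformlyOn (sarasonPoly a) (sarasonFun a) Filter.atTop (ball 0 1) := by
  refine tendstoLocallyUniformlyOn_unit_ball fun ρ hρ => ?_
  have h := tendstoUniformlyOn_tsum (f := sarasonTerm a) (s := ball 0 ρ)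
    (summable_mul_pow_dist ha (fun n => by positivity) hρ)
    fun i z hz => norm_sarasonTerm_le a i (mem_ball_zero_iff.1 hz).le
  have hN : Filter.Tendsto (fun N => Finset.range N ×ˢ Finset.range N) Filter.atTop
      Filter.atTop :=
    Filter.tendsto_finsetProd_atTop.comp
      ((Filter.tendsto_finset_range.prodMk Filter.tendsto_finset_range).mono_right
        Filter.prod_atTop_atTop_eq.le)
  rw [Metric.tendstoUniformlyOn_iff] at h ⊢
  intro ε hε
  filter_upwards [hN.eventually (h ε hε)] with N hN z hz
  simpa only [sarasonFun, sarasonPoly, dist_add_left] using hN z hz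

/-- Fatou's lemma as an integrability criterion. -/
theorem integrable_of_tendsto_of_integral_le {α : Type*} [MeasurableSpace α] {μ : Measure α}
    {u : ℕ → α → ℝ} {v : α → ℝ} {C : ℝ} (hu : ∀ N, Integrable (u N) μ) (hu0 : ∀ N x, 0 ≤ u N x)
    (hC : ∀ N, ∫ x, u N x ∂μ ≤ C)
    (hv : ∀ᵐ x ∂μ, Filter.Tendsto (fun N => u N x) Filter.atTop (nhds (v x))) :
    Integrable v μ := by
  refine ⟨aestronglyMeasurable_of_tendsto_ae _ (fun N => (hu N).aestronglyMeasurable) hv, ?_⟩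
  have h1 : ∀ᵐ x ∂μ, ‖v x‖ₑ = Filter.liminf (fun N => ‖u N x‖ₑ) Filter.atTop :=
    hv.mono fun x hx => hx.enorm.liminf_eq.symm
  have h2 : ∀ N, ∫⁻ x, ‖u N x‖ₑ ∂μ ≤ ENNReal.ofReal C := fun N => by
    rw [← ofReal_integral_norm_eq_lintegral_enorm (hu N)]
    refine ENNReal.ofReal_le_ofReal (le_trans (le_of_eq ?_) (hC N))
    simp only [Real.norm_of_nonneg (hu0 N _)]
  calc ∫⁻ x, ‖v x‖ₑ ∂μ = ∫⁻ x, Filter.liminf (fun N => ‖u N x‖ₑ) Filter.atTop ∂μ :=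
        lintegral_congr_ae h1
    _ ≤ Filter.liminf (fun N => ∫⁻ x, ‖u N x‖ₑ ∂μ) Filter.atTop :=
        lintegral_liminf_le' fun N => (hu N).aestronglyMeasurable.enorm
    _ ≤ ENNReal.ofReal C :=
        Filter.liminf_le_of_le (by isBoundedDefault) fun b hb =>
          let ⟨N, hN⟩ := hb.exists
          hN.trans (h2 N)
    _ < ⊤ := ENNReal.ofReal_lt_top

theorem one_le_re_sarasonFun_sub {a : ℕ → ℂ} {f : ℂ → ℂ} (ha : DirichletSummable a)
    (hf : ∀ z ∈ ball (0 : ℂ) 1, HasSum (fun n => a n * z ^ n) (f z)) {z : ℂ}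
    (hz : z ∈ ball (0 : ℂ) 1) : 1 ≤ (sarasonFun a z).re - ‖f z‖ ^ 2 :=
  ge_of_tendsto' (((continuous_re.tendsto _).comp
    ((tendstoLocallyUniformlyOn_sarasonPoly ha).tendsto_at hz)).sub
      (((tendstoLocallyUniformlyOn_coeffPoly hf).tendsto_at hz).norm.pow 2))
    fun N => one_le_re_sarasonPoly_sub a N (ball_subset_closedBall hz)

theorem one_le_norm_of_one_le_re_sub {v : ℂ} {x : ℝ} (h : 1 ≤ v.re - x ^ 2) : 1 ≤ ‖v‖ := by
  nlinarith [re_le_norm v, sq_nonneg x]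

theorem sarasonFun_ne_zero {a : ℕ → ℂ} {f : ℂ → ℂ} (ha : DirichletSummable a)
    (hf : ∀ z ∈ ball (0 : ℂ) 1, HasSum (fun n => a n * z ^ n) (f z)) {z : ℂ}
    (hz : z ∈ ball (0 : ℂ) 1) : sarasonFun a z ≠ 0 := by
  rw [← norm_pos_iff]
  linarith [one_le_norm_of_one_le_re_sub (one_le_re_sarasonFun_sub ha hf hz)]

/-- If `V` is the Sarason function of `f`, and `q` is a limit of polynomials dominated by the
Taylor polynomials of `f` in the sense of `dirichlet_bound_div_mul`, then `q / V` is a multiplier. -/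
theorem memMultiplierD_div_sarasonFun {a : ℕ → ℂ} {f q : ℂ → ℂ} {Q : ℕ → ℂ → ℂ}
    (ha : DirichletSummable a)
    (hf : ∀ z ∈ ball (0 : ℂ) 1, HasSum (fun n => a n * z ^ n) (f z))
    (hQ : ∀ N, Differentiable ℂ (Q N))
    (hQq : TendstoLocallyUniformlyOn Q q Filter.atTop (ball 0 1))
    (hQV : ∀ N, ∀ z ∈ closedBall (0 : ℂ) 1, ‖Q N z‖ ^ 2 ≤ ‖sarasonPoly a N z‖)
    (hQp : ∀ N z, ‖deriv (Q N) z‖ ≤ ‖deriv (coeffPoly a N) z‖) :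
    MemMultiplierD (fun z => q z / sarasonFun a z) := by
  have hV := tendstoLocallyUniformlyOn_sarasonPoly ha
  have hdV : ∀ᶠ N in Filter.atTop, DifferentiableOn ℂ (sarasonPoly a N) (ball 0 1) :=
    Filter.Eventually.of_forall fun N => (differentiable_sarasonPoly a N).differentiableOn
  have hdQ : ∀ᶠ N in Filter.atTop, DifferentiableOn ℂ (Q N) (ball 0 1) :=
    Filter.Eventually.of_forall fun N => (hQ N).differentiableOn
  have hVd := hV.differentiableOn hdV isOpen_ball
  have hqd := hQq.differentiableOn hdQ isOpen_ball
  have hV0 : ∀ z ∈ ball (0 : ℂ) 1, sarasonFun a z ≠ 0 := fun z hz => sarasonFun_ne_zero ha hf hz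
  have hVN0 : ∀ N, ∀ z ∈ ball (0 : ℂ) 1, sarasonPoly a N z ≠ 0 := fun N z hz => by
    rw [← norm_pos_iff]
    linarith [one_le_norm_of_one_le_re_sub
      (one_le_re_sarasonPoly_sub a N (ball_subset_closedBall hz))]
  have hqV := hqd.div hVd hV0
  refine ⟨hqV, fun g hg => ⟨hqV.mul hg.1, ?_⟩⟩
  obtain ⟨b, hb, hgb⟩ := hg.exists_hasSum
  obtain ⟨C, hC⟩ := exists_dirichlet_coeffPoly_le hb
  have hφ := tendstoLocallyUniformlyOn_coeffPoly hgb
  have hdφ : ∀ᶠ N in Filter.atTop, DifferentiableOn ℂ (coeffPoly b N) (ball 0 1) :=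
    Filter.Eventually.of_forall fun N => (differentiable_coeffPoly b N).differentiableOn
  have hbound := fun N => dirichlet_bound_div_mul (differentiable_coeffPoly a N) (hQ N)
    (differentiable_sarasonPoly a N) (differentiable_coeffPoly b N)
    (fun z hz => one_le_re_sarasonPoly_sub a N hz) (fun z hz => sarasonPoly_boundary a N hz)
    (hQV N) (hQp N)
  refine integrable_of_tendsto_of_integral_le (C := 146 * C) (fun N => (hbound N).1)
    (fun N z => by positivity) (fun N => (hbound N).2.trans (by linarith [hC N]))
    ((ae_restrict_mem measurableSet_ball).mono fun z hz => ?_)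
  refine Filter.Tendsto.pow (Filter.Tendsto.norm ?_) 2
  have hderiv : ∀ {q V φ : ℂ → ℂ}, DifferentiableAt ℂ q z → DifferentiableAt ℂ V z →
      DifferentiableAt ℂ φ z → V z ≠ 0 → deriv (fun w => q w / V w * φ w) z =
        (deriv q z * V z - q z * deriv V z) / V z ^ 2 * φ z + q z / V z * deriv φ z :=
    fun hq hV hφ h0 =>
      ((hq.hasDerivAt.div hV.hasDerivAt h0).mul hφ.hasDerivAt).deriv
  have hnhds := isOpen_ball.mem_nhds hz
  have hlim : deriv ((fun z => q z / sarasonFun a z) * g) z = _ :=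
    hderiv (hqd.differentiableAt hnhds) (hVd.differentiableAt hnhds)
      (hg.1.differentiableAt hnhds) (hV0 z hz)
  rw [hlim]
  simp only [hderiv (hQ _ z) (differentiable_sarasonPoly a _ z) (differentiable_coeffPoly b _ z)
    (hVN0 _ z hz)]
  have tQ := hQq.tendsto_at hz
  have tV := hV.tendsto_at hz
  have tφ := hφ.tendsto_at hz
  have tQ' := (hQq.deriv hdQ isOpen_ball).tendsto_at hz
  have tV' := (hV.deriv hdV isOpen_ball).tendsto_at hz
  have tφ' := (hφ.deriv hdφ isOpen_ball).tendsto_at hz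
  exact ((((tQ'.mul tV).sub (tQ.mul tV')).div (tV.pow 2) (pow_ne_zero 2 (hV0 z hz))).mul tφ).add
    ((tQ.div tV (hV0 z hz)).mul tφ')

/-- Every function in the Dirichlet space is a quotient `h/k` of two
multipliers of the Dirichlet space, with `k` nowhere vanishing on `𝔻`. -/
theorem dirichlet_quotient_of_multipliers (f : ℂ → ℂ) (hf : MemDirichlet f) :
    ∃ h k : ℂ → ℂ, MemMultiplierD h ∧ MemMultiplierD k ∧
      (∀ z ∈ Metric.ball (0 : ℂ) 1, k z ≠ 0) ∧
      (∀ z ∈ Metric.ball (0 : ℂ) 1, f z = h z / k z) := by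
  obtain ⟨a, ha, hfa⟩ := hf.exists_hasSum
  have hV0 : ∀ z ∈ ball (0 : ℂ) 1, sarasonFun a z ≠ 0 := fun z hz => sarasonFun_ne_zero ha hfa hz
  refine ⟨fun z => f z / sarasonFun a z, fun z => 1 / sarasonFun a z, ?_, ?_,
    fun z hz => one_div_ne_zero (hV0 z hz), fun z hz => ?_⟩
  · refine memMultiplierD_div_sarasonFun ha hfa (differentiable_coeffPoly a)
      (tendstoLocallyUniformlyOn_coeffPoly hfa) (fun N z hz => ?_) fun N z => le_rfl
    linarith [one_le_re_sarasonPoly_sub a N hz, re_le_norm (sarasonPoly a N z)]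
  · refine memMultiplierD_div_sarasonFun (Q := fun _ _ => 1) ha hfa
      (fun N => differentiable_const _) (fun u hu x _ => ⟨univ, Filter.univ_mem,
        Filter.Eventually.of_forall fun N y _ => refl_mem_uniformity hu⟩) (fun N z hz => ?_)
      fun N z => by simp
    simpa using one_le_norm_of_one_le_re_sub (one_le_re_sarasonPoly_sub a N hz)
  · have := hV0 z hz
    field_simp
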